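/- arXiv:1910.06879 — 3 statements merged into one kernel-verified Lean document; each statement's English description precedes it below -/
import Mathlib

section
/- Let n ≥ 2 and q > 0. There exist positive constants C and C̃ depending only on n and q such that for every a ∈ (0, 1/3), C·G(a) ≤ ∫₀^{π/3} (θ² + a²)^{−q/2} θ^{n−2} dθ ≤ C̃·G(a), where G(a) = 1 if 0 < q < n−1, G(a) = |log a| if q = n−1, and G(a) = a^{n−1−q} if q > n−1. -/
open MeasureTheory Real
open scoped ENNReal Topology

noncomputable section

/-- For `0 < y`, the kernel `(x² + y²)^{-q/2}` is at most `y^{-q}`. -/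
lemma sq_add_sq_rpow_le {x y q : ℝ} (hy : 0 < y) (hq : 0 < q) :
    (x ^ 2 + y ^ 2) ^ (-(q / 2)) ≤ y ^ (-q) := by
  have h : y ^ (-q) = (y ^ 2) ^ (-(q / 2)) := by
    rw [← Real.rpow_natCast, ← Real.rpow_mul hy.le]
    congr 1
    push_cast
    ring
  rw [h]
  exact Real.rpow_le_rpow_of_nonpos (by positivity) (by nlinarith [sq_nonneg x]) (by linarith)

/-- For `0 ≤ x ≤ y`, the kernel `(x² + y²)^{-q/2}` is at least `2^{-q/2} y^{-q}`. -/
lemma le_sq_add_sq_rpow {x y q : ℝ} (hx : 0 ≤ x) (hxy : x ≤ y) (hy : 0 < y) (hq : 0 < q) :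
    2 ^ (-(q / 2)) * y ^ (-q) ≤ (x ^ 2 + y ^ 2) ^ (-(q / 2)) := by
  have h : y ^ (-q) = (y ^ 2) ^ (-(q / 2)) := by
    rw [← Real.rpow_natCast, ← Real.rpow_mul hy.le]
    congr 1
    push_cast
    ring
  rw [h, ← Real.mul_rpow (by norm_num) (by positivity)]
  exact Real.rpow_le_rpow_of_nonpos (by positivity) (by nlinarith) (by linarith)

/-- Splitting the integral at `a` and replacing the kernel by the power of the larger of
`θ` and `a` on each piece. -/
lemma integral_sq_add_sq_rpow_mul_pow_bounds (m : ℕ) {a b q : ℝ} (ha : 0 < a) (hab : a ≤ b)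
    (hq : 0 < q) :
    2 ^ (-(q / 2)) * (a ^ ((m : ℝ) + 1 - q) / (m + 1) + ∫ θ in a..b, θ ^ ((m : ℝ) - q)) ≤
        ∫ θ in (0 : ℝ)..b, (θ ^ 2 + a ^ 2) ^ (-(q / 2)) * θ ^ m ∧
      ∫ θ in (0 : ℝ)..b, (θ ^ 2 + a ^ 2) ^ (-(q / 2)) * θ ^ m ≤
        a ^ ((m : ℝ) + 1 - q) / (m + 1) + ∫ θ in a..b, θ ^ ((m : ℝ) - q) := by
  have hf : Continuous fun θ : ℝ => (θ ^ 2 + a ^ 2) ^ (-(q / 2)) * θ ^ m := by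
    refine Continuous.mul (Continuous.rpow_const (by fun_prop) fun x => Or.inl ?_) (by fun_prop)
    positivity
  have hg : IntervalIntegrable (fun θ : ℝ => θ ^ ((m : ℝ) - q)) volume a b := by
    refine intervalIntegral.intervalIntegrable_rpow (Or.inr ?_)
    exact Set.notMem_uIcc_of_lt ha (ha.trans_le hab)
  have hsplit := intervalIntegral.integral_add_adjacent_intervals
    (hf.intervalIntegrable (μ := volume) 0 a) (hf.intervalIntegrable (μ := volume) a b)
  have hnear : ∫ θ in (0 : ℝ)..a, a ^ (-q) * θ ^ m = a ^ ((m : ℝ) + 1 - q) / (m + 1) := by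
    have h : a ^ ((m : ℝ) + 1 - q) = a ^ (-q) * a ^ (m + 1) := by
      rw [← Real.rpow_natCast, ← Real.rpow_add ha]
      congr 1
      push_cast
      ring
    rw [intervalIntegral.integral_const_mul, integral_pow, h]
    simp
    ring
  have hpow : ∀ θ ∈ Set.Icc a b, θ ^ ((m : ℝ) - q) = θ ^ (-q) * θ ^ m := fun θ hθ => by
    have h0 : 0 < θ := ha.trans_le hθ.1
    rw [← Real.rpow_natCast, ← Real.rpow_add h0]
    congr 1
    ring
  have hp : Continuous fun θ : ℝ => a ^ (-q) * θ ^ m := by fun_prop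
  rw [← hsplit, ← hnear, mul_add, ← intervalIntegral.integral_const_mul,
    ← intervalIntegral.integral_const_mul]
  refine ⟨add_le_add ?_ ?_, add_le_add ?_ ?_⟩
  · refine intervalIntegral.integral_mono_on ha.le ((hp.const_mul _).intervalIntegrable _ _)
      (hf.intervalIntegrable _ _) fun θ hθ => ?_
    rw [← mul_assoc]
    exact mul_le_mul_of_nonneg_right (le_sq_add_sq_rpow hθ.1 hθ.2 ha hq) (pow_nonneg hθ.1 _)
  · refine intervalIntegral.integral_mono_on hab (hg.const_mul _)
      (hf.intervalIntegrable _ _) fun θ hθ => ?_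
    have h0 : 0 < θ := ha.trans_le hθ.1
    rw [hpow θ hθ, ← mul_assoc, add_comm (θ ^ 2)]
    exact mul_le_mul_of_nonneg_right (le_sq_add_sq_rpow ha.le hθ.1 h0 hq) (pow_nonneg h0.le _)
  · refine intervalIntegral.integral_mono_on ha.le (hf.intervalIntegrable _ _)
      (hp.intervalIntegrable _ _) fun θ hθ => ?_
    exact mul_le_mul_of_nonneg_right (sq_add_sq_rpow_le ha hq) (pow_nonneg hθ.1 _)
  · refine intervalIntegral.integral_mono_on hab (hf.intervalIntegrable _ _) hg fun θ hθ => ?_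
    have h0 : 0 < θ := ha.trans_le hθ.1
    rw [hpow θ hθ, add_comm (θ ^ 2)]
    exact mul_le_mul_of_nonneg_right (sq_add_sq_rpow_le h0 hq) (pow_nonneg h0.le _)

/-- The comparison function `a^{s-q}/s + ∫_a^b θ^{s-1-q} dθ` has the order of the
trichotomy in `q < s`, `q = s`, `q > s` as `a` ranges over `(0, 1/3)`. -/
lemma exists_rpow_div_add_integral_rpow_bounds {s b : ℝ} (hs : 0 < s) (hb : 1 < b) (q : ℝ) :
    ∃ C C' : ℝ, 0 < C ∧ 0 < C' ∧ ∀ a : ℝ, 0 < a → a < 1 / 3 →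
      C * (if q < s then 1 else if q = s then |Real.log a| else a ^ (s - q)) ≤
        a ^ (s - q) / s + ∫ θ in a..b, θ ^ (s - 1 - q) ∧
      a ^ (s - q) / s + ∫ θ in a..b, θ ^ (s - 1 - q) ≤
        C' * (if q < s then 1 else if q = s then |Real.log a| else a ^ (s - q)) := by
  have hb0 : 0 < b := by linarith
  have hint : q ≠ s → ∀ a : ℝ, 0 < a →
      ∫ θ in a..b, θ ^ (s - 1 - q) = (b ^ (s - q) - a ^ (s - q)) / (s - q) := by
    intro hqs a ha
    rw [integral_rpow (Or.inr ⟨fun h => hqs (by linarith), Set.notMem_uIcc_of_lt ha hb0⟩)]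
    rw [show s - 1 - q + 1 = s - q by ring]
  rcases lt_trichotomy q s with h | h | h
  · have hp : 0 < s - q := by linarith
    have hb1 : 1 < b ^ (s - q) := Real.one_lt_rpow hb hp
    refine ⟨(b ^ (s - q) - 1) / (s - q), b ^ (s - q) / (s - q) + 1 / s, div_pos (by linarith) hp,
      by positivity, fun a ha ha3 => ?_⟩
    have ha1 : a ^ (s - q) ≤ 1 := Real.rpow_le_one ha.le (by linarith) hp.le
    have ha0 : 0 < a ^ (s - q) := Real.rpow_pos_of_pos ha _
    rw [hint h.ne a ha]
    simp only [h, if_true, mul_one]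
    constructor
    · have h1 : (b ^ (s - q) - 1) / (s - q) ≤ (b ^ (s - q) - a ^ (s - q)) / (s - q) := by gcongr
      have h2 : 0 < a ^ (s - q) / s := by positivity
      linarith
    · have h1 : (b ^ (s - q) - a ^ (s - q)) / (s - q) ≤ b ^ (s - q) / (s - q) := by
        gcongr; linarith
      have h2 : a ^ (s - q) / s ≤ 1 / s := by gcongr
      linarith
  · subst h
    have hlb : 0 < Real.log b := Real.log_pos hb
    refine ⟨1, 1 / q + Real.log b + 1, one_pos, by positivity, fun a ha ha3 => ?_⟩
    have hla : 1 ≤ -Real.log a := by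
      have h1 : Real.log a ≤ -1 := by
        rw [Real.log_le_iff_le_exp ha, Real.exp_neg]
        refine ha3.le.trans ?_
        rw [one_div]
        exact inv_anti₀ (Real.exp_pos 1) (by linarith [Real.exp_one_lt_d9])
      linarith
    have hJ : ∫ θ in a..b, θ ^ (q - 1 - q) = Real.log b - Real.log a := by
      rw [← Real.log_div hb0.ne' ha.ne', ← integral_inv_of_pos ha hb0]
      refine intervalIntegral.integral_congr fun θ _ => ?_
      simp [Real.rpow_neg_one]
    rw [hJ, sub_self, Real.rpow_zero, if_neg (lt_irrefl q), if_pos rfl,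
      abs_of_nonpos (by linarith)]
    have hqi : 0 < 1 / q := by positivity
    constructor <;> nlinarith
  · have hr : 0 < q - s := by linarith
    refine ⟨1 / s, 1 / s + 1 / (q - s), by positivity, by positivity, fun a ha ha3 => ?_⟩
    have hJ : ∫ θ in a..b, θ ^ (s - 1 - q) = (a ^ (s - q) - b ^ (s - q)) / (q - s) := by
      rw [hint h.ne' a ha, ← neg_sub q s, ← neg_div_neg_eq, neg_neg, neg_sub]
    have hba : b ^ (s - q) ≤ a ^ (s - q) :=
      Real.rpow_le_rpow_of_nonpos ha (by linarith) (by linarith)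
    have hb1 : 0 < b ^ (s - q) := Real.rpow_pos_of_pos hb0 _
    rw [hJ, if_neg h.not_gt, if_neg h.ne']
    constructor
    · have h1 : 0 ≤ (a ^ (s - q) - b ^ (s - q)) / (q - s) := div_nonneg (by linarith) hr.le
      have h2 : 1 / s * a ^ (s - q) = a ^ (s - q) / s := by ring
      linarith
    · have h1 : (a ^ (s - q) - b ^ (s - q)) / (q - s) ≤ a ^ (s - q) / (q - s) := by
        gcongr; linarith
      have h2 : (1 / s + 1 / (q - s)) * a ^ (s - q) =
          a ^ (s - q) / s + a ^ (s - q) / (q - s) := by ring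
      linarith

/-- two-sided estimate in Case `𝒜₃` of the paper.
For `0 < a < 1/3`, `∫₀^{π/3} (θ² + a²)^{-q/2} θ^{n-2} dθ` is comparable to `G(a)`,
where `G(a) = 1` if `q < n-1`, `G(a) = |log a|` if `q = n-1`, and
`G(a) = a^{n-1-q}` if `q > n-1`. -/
theorem integral_theta_comparable_a_small
    (n : ℕ) (hn : 2 ≤ n) (q : ℝ) (hq : 0 < q) :
    ∃ C C' : ℝ, 0 < C ∧ 0 < C' ∧ ∀ a : ℝ, 0 < a → a < 1 / 3 →
      C * (if q < (n : ℝ) - 1 then 1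
           else if q = (n : ℝ) - 1 then |Real.log a| else a ^ ((n : ℝ) - 1 - q)) ≤
        (∫ θ in Set.Ioo (0 : ℝ) (π / 3), (θ ^ 2 + a ^ 2) ^ (-(q / 2)) * θ ^ (n - 2)) ∧
      (∫ θ in Set.Ioo (0 : ℝ) (π / 3), (θ ^ 2 + a ^ 2) ^ (-(q / 2)) * θ ^ (n - 2)) ≤
        C' * (if q < (n : ℝ) - 1 then 1
              else if q = (n : ℝ) - 1 then |Real.log a| else a ^ ((n : ℝ) - 1 - q)) := by
  have hm : (n : ℝ) - 1 = ((n - 2 : ℕ) : ℝ) + 1 := by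
    rw [Nat.cast_sub hn]
    push_cast
    ring
  have hb : 1 < π / 3 := by linarith [Real.pi_gt_three]
  obtain ⟨C, C', hC, hC', h⟩ := exists_rpow_div_add_integral_rpow_bounds
    (s := ((n - 2 : ℕ) : ℝ) + 1) (by positivity) hb q
  have hc : (0 : ℝ) < 2 ^ (-(q / 2)) := by positivity
  refine ⟨2 ^ (-(q / 2)) * C, C', by positivity, hC', fun a ha ha3 => ?_⟩
  obtain ⟨hlow, hupp⟩ := h a ha ha3
  obtain ⟨hlow', hupp'⟩ := integral_sq_add_sq_rpow_mul_pow_bounds (n - 2) (a := a) (b := π / 3)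
    ha (by linarith) hq
  rw [add_sub_cancel_right] at hlow hupp
  rw [← integral_Ioc_eq_integral_Ioo, ← intervalIntegral.integral_of_le (by linarith), hm,
    mul_assoc]
  exact ⟨(mul_le_mul_of_nonneg_left hlow hc.le).trans hlow', hupp'.trans hupp⟩
end
end

section
/- Let n ≥ 2, β ≥ 0, δ > 0 and c₀ ∈ (0, 1). There exists a constant C > 0 depending only on n, β, δ and c₀ such that for every ε ∈ (0, 1/2), ∫_{{x ∈ S^{n−1} : |x_n| < c₀}} |x_n|^β (ε²|x'|² + x_n²)^{−(β+δ+1)/2} dx ≥ C ε^{−δ}. -/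
open MeasureTheory Metric Real
open scoped ENNReal Topology

noncomputable section

/-- The standard surface measure on the unit sphere `S^{n-1} ⊆ ℝⁿ`,
viewed as a measure on the ambient space `ℝⁿ` supported on the sphere. -/
def sphereMeasure (n : ℕ) : Measure (EuclideanSpace ℝ (Fin n)) :=
  Measure.map Subtype.val ((volume : Measure (EuclideanSpace ℝ (Fin n))).toSphere)

/-- The last coordinate `x_n` of a point `x ∈ ℝⁿ`. -/
def lastCoord {n : ℕ} (x : EuclideanSpace ℝ (Fin n)) : ℝ :=
  if h : n = 0 then 0 else x ⟨n - 1, Nat.sub_lt (Nat.pos_of_ne_zero h) one_pos⟩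

/-- The Euclidean norm `|x'|` of the vector of first `n-1` coordinates of `x ∈ ℝⁿ`. -/
def primeNorm {n : ℕ} (x : EuclideanSpace ℝ (Fin n)) : ℝ :=
  Real.sqrt (∑ i : Fin n, if (i : ℕ) < n - 1 then x i ^ 2 else 0)

theorem lastCoord_succ {m : ℕ} (x : EuclideanSpace ℝ (Fin (m + 1))) :
    lastCoord x = x (Fin.last m) := by
  simp [lastCoord, Fin.last]

theorem primeNorm_sq_succ {m : ℕ} (x : EuclideanSpace ℝ (Fin (m + 1))) :
    primeNorm x ^ 2 = ∑ i : Fin m, x i.castSucc ^ 2 := by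
  unfold primeNorm
  rw [Real.sq_sqrt (Finset.sum_nonneg fun i _ => by split_ifs <;> positivity),
    Fin.sum_univ_castSucc]
  simp

theorem primeNorm_sq_add_lastCoord_sq {m : ℕ} (x : EuclideanSpace ℝ (Fin (m + 1))) :
    primeNorm x ^ 2 + lastCoord x ^ 2 = ‖x‖ ^ 2 := by
  rw [primeNorm_sq_succ, lastCoord_succ, EuclideanSpace.real_norm_sq_eq, Fin.sum_univ_castSucc]

theorem measurable_lastCoord {m : ℕ} :
    Measurable (lastCoord : EuclideanSpace ℝ (Fin (m + 1)) → ℝ) := by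
  simp_rw [funext lastCoord_succ]
  fun_prop

theorem measurable_primeNorm {n : ℕ} :
    Measurable (primeNorm : EuclideanSpace ℝ (Fin n) → ℝ) := by
  unfold primeNorm
  refine Real.continuous_sqrt.measurable.comp (Finset.measurable_sum _ fun i _ => ?_)
  split_ifs <;> fun_prop

theorem ae_norm_eq_one_sphereMeasure (n : ℕ) : ∀ᵐ x ∂(sphereMeasure n), ‖x‖ = 1 := by
  unfold sphereMeasure
  rw [ae_map_iff measurable_subtype_coe.aemeasurable
    (measurableSet_eq_fun measurable_norm measurable_const)]
  exact Filter.Eventually.of_forall fun x => by simp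

instance isFiniteMeasure_sphereMeasure (n : ℕ) : IsFiniteMeasure (sphereMeasure n) := by
  unfold sphereMeasure
  infer_instance

/-- The box `[r, 2r]^m × [u, v]` has volume `r ^ m * (v - u)`. -/
theorem volume_box {m : ℕ} {r u v : ℝ} (hr : 0 ≤ r) :
    volume {y : EuclideanSpace ℝ (Fin (m + 1)) |
      (∀ i : Fin m, y i.castSucc ∈ Set.Icc r (2 * r)) ∧ y (Fin.last m) ∈ Set.Icc u v} =
    ENNReal.ofReal (r ^ m * (v - u)) := by
  let t : Fin (m + 1) → Set ℝ := Fin.snoc (fun _ : Fin m => Set.Icc r (2 * r)) (Set.Icc u v)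
  have ht : MeasurableSet (Set.univ.pi t) := by
    refine MeasurableSet.univ_pi fun i => ?_
    refine Fin.lastCases ?_ (fun j => ?_) i <;> simp [t]
  have h := (PiLp.volume_preserving_ofLp (Fin (m + 1))).measure_preimage ht.nullMeasurableSet
  have hset : {y : EuclideanSpace ℝ (Fin (m + 1)) |
      (∀ i : Fin m, y i.castSucc ∈ Set.Icc r (2 * r)) ∧ y (Fin.last m) ∈ Set.Icc u v} =
      WithLp.ofLp ⁻¹' Set.univ.pi t := by
    ext y
    simp only [Set.mem_ofPred_eq, Set.mem_preimage, Set.mem_univ_pi, Fin.forall_fin_succ', t,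
      Fin.snoc_castSucc, Fin.snoc_last]
  rw [hset, h, volume_pi_pi, Fin.prod_univ_castSucc]
  simp only [t, Fin.snoc_castSucc, Fin.snoc_last, Real.volume_Icc, Finset.prod_const,
    Finset.card_univ, Fintype.card_fin]
  rw [ENNReal.ofReal_mul (by positivity), ENNReal.ofReal_pow hr]
  ring_nf

/-- Spherical bands near the equator at height comparable to `ε` have measure at least
a multiple of `ε`. -/
theorem sphereMeasure_band_ge {m : ℕ} (hm : 1 ≤ m) {r c ε : ℝ} (hr : 0 < r)
    (hrm : 4 * (m + 1) * r ≤ 1) (hc : 0 < c) (hc' : c < 1) (hε : 0 < ε) (hε' : ε < 1) :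
    r ^ m * (c * r / 2 * ε) ≤ (sphereMeasure (m + 1)).real
      {x | c * r / 2 * ε ≤ lastCoord x ∧ lastCoord x ≤ c * ε} := by
  have hmeas : MeasurableSet {x : EuclideanSpace ℝ (Fin (m + 1)) |
      c * r / 2 * ε ≤ lastCoord x ∧ lastCoord x ≤ c * ε} :=
    (measurableSet_le measurable_const measurable_lastCoord).inter
      (measurableSet_le measurable_lastCoord measurable_const)
  refine (ENNReal.ofReal_le_iff_le_toReal (measure_ne_top _ _)).1 ?_
  rw [sphereMeasure, Measure.map_apply measurable_subtype_coe hmeas,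
    Measure.toSphere_apply' _ (measurable_subtype_coe hmeas)]
  have hbox := volume_box (m := m) (r := r) (u := c * r / 2 * ε) (v := c * r * ε) hr.le
  have hsub : c * r * ε - c * r / 2 * ε = c * r / 2 * ε := by ring
  rw [hsub] at hbox
  rw [← hbox]
  refine le_trans (measure_mono ?_) (le_mul_of_one_le_left zero_le ?_)
  · rintro y ⟨hy, hl⟩
    have hyr : r ≤ ‖y‖ := by
      have h1 := PiLp.norm_apply_le y (Fin.castSucc ⟨0, hm⟩)
      have h2 := (hy ⟨0, hm⟩).1
      exact h2.trans ((le_abs_self _).trans h1)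
    have hy0 : 0 < ‖y‖ := hr.trans_le hyr
    have hl2 : y (Fin.last m) ≤ 2 * r := by
      have : c * ε ≤ 1 := by nlinarith
      nlinarith [hl.2]
    have hl0 : 0 < c * r / 2 * ε := by positivity
    have hy1 : ‖y‖ < 1 := by
      have hsq : ‖y‖ ^ 2 ≤ (m + 1) * (2 * r) ^ 2 := by
        rw [EuclideanSpace.real_norm_sq_eq]
        refine (Finset.sum_le_card_nsmul _ _ ((2 * r) ^ 2) fun i _ => ?_).trans (by simp)
        refine Fin.lastCases ?_ (fun j => ?_) i
        · exact pow_le_pow_left₀ (hl0.le.trans hl.1) hl2 2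
        · exact pow_le_pow_left₀ (hr.le.trans (hy j).1) (hy j).2 2
      have hr1 : r < 1 := by nlinarith [(Nat.cast_nonneg m : (0 : ℝ) ≤ m)]
      nlinarith
    refine Set.mem_smul.2 ⟨‖y‖, ⟨hy0, hy1⟩, ‖y‖⁻¹ • y, ?_, ?_⟩
    · refine ⟨⟨‖y‖⁻¹ • y, ?_⟩, ?_, rfl⟩
      · simp [norm_smul, hy0.ne']
      · simp only [Set.mem_preimage, Set.mem_ofPred_eq, lastCoord_succ, PiLp.smul_apply,
          smul_eq_mul]
        rw [inv_mul_eq_div, le_div_iff₀ hy0, div_le_iff₀ hy0]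
        have := hl.1
        have := hl.2
        have : 0 < c * ε := by positivity
        constructor <;> nlinarith
    · rw [smul_smul, mul_inv_cancel₀ hy0.ne', one_smul]
  · simp

/-- estimates (4.19)–(4.22) of the paper.
For `β ≥ 0`, `δ > 0` and `c₀ ∈ (0,1)`, there is `C > 0` such that for every
`ε ∈ (0, 1/2)`,
`∫_{{|x_n| < c₀}} |x_n|^β (ε²|x'|² + x_n²)^{-(β+δ+1)/2} dx ≥ C ε^{-δ}`. -/
theorem sphere_integral_lower_bound
    (n : ℕ) (hn : 2 ≤ n) (β δ c₀ : ℝ) (hβ : 0 ≤ β) (hδ : 0 < δ)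
    (hc₀ : 0 < c₀) (hc₀' : c₀ < 1) :
    ∃ C : ℝ, 0 < C ∧ ∀ ε : ℝ, 0 < ε → ε < 1 / 2 →
      C * ε ^ (-δ) ≤
        ∫ x in {x : EuclideanSpace ℝ (Fin n) | |lastCoord x| < c₀},
          |lastCoord x| ^ β *
            (ε ^ 2 * primeNorm x ^ 2 + lastCoord x ^ 2) ^ (-((β + δ + 1) / 2))
          ∂(sphereMeasure n) := by
  obtain ⟨m, rfl⟩ : ∃ m, n = m + 1 := ⟨n - 1, by omega⟩
  have hm : 1 ≤ m := by omega
  obtain ⟨r, hr, hrm⟩ : ∃ r : ℝ, 0 < r ∧ 4 * (m + 1) * r ≤ 1 :=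
    ⟨1 / (4 * (m + 1)), by positivity, by field_simp; rfl⟩
  set p : ℝ := (β + δ + 1) / 2 with hp
  have hp0 : 0 < p := by positivity
  refine ⟨(c₀ * r / 2) ^ β * 2 ^ (-p) * (r ^ m * (c₀ * r / 2)), by positivity,
    fun ε hε hε2 => ?_⟩
  set F : EuclideanSpace ℝ (Fin (m + 1)) → ℝ := fun x =>
    |lastCoord x| ^ β * (ε ^ 2 * primeNorm x ^ 2 + lastCoord x ^ 2) ^ (-p)
  set T : Set (EuclideanSpace ℝ (Fin (m + 1))) :=
    {x | c₀ * r / 2 * ε ≤ lastCoord x ∧ lastCoord x ≤ c₀ * ε}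
  have hTm : MeasurableSet T :=
    (measurableSet_le measurable_const measurable_lastCoord).inter
      (measurableSet_le measurable_lastCoord measurable_const)
  have hF0 : ∀ x, 0 ≤ F x := fun x => by positivity
  have hFm : Measurable F := by
    have := @measurable_lastCoord m
    have := @measurable_primeNorm (m + 1)
    fun_prop
  have hFi : Integrable F (sphereMeasure (m + 1)) := by
    refine Integrable.of_bound hFm.aestronglyMeasurable ((ε ^ 2) ^ (-p)) ?_
    filter_upwards [ae_norm_eq_one_sphereMeasure (m + 1)] with x hx
    have hn := primeNorm_sq_add_lastCoord_sq x
    rw [hx] at hn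
    rw [Real.norm_of_nonneg (hF0 x)]
    have h1 : |lastCoord x| ^ β ≤ 1 :=
      Real.rpow_le_one (abs_nonneg _) (abs_le_one_iff_mul_self_le_one.2
        (by nlinarith [sq_nonneg (primeNorm x)])) hβ
    have h2 : (ε ^ 2 * primeNorm x ^ 2 + lastCoord x ^ 2) ^ (-p) ≤ (ε ^ 2) ^ (-p) := by
      refine Real.rpow_le_rpow_of_nonpos (by positivity) ?_ (by linarith)
      nlinarith [mul_nonneg (sq_nonneg (lastCoord x)) (by nlinarith : 0 ≤ 1 - ε ^ 2)]
    calc F x ≤ 1 * (ε ^ 2) ^ (-p) := mul_le_mul h1 h2 (by positivity) zero_le_one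
      _ = _ := one_mul _
  have hlow : ∀ᵐ x ∂(sphereMeasure (m + 1)), x ∈ T →
      (c₀ * r / 2 * ε) ^ β * (2 * ε ^ 2) ^ (-p) ≤ F x := by
    filter_upwards [ae_norm_eq_one_sphereMeasure (m + 1)] with x hx hxT
    have hn := primeNorm_sq_add_lastCoord_sq x
    rw [hx] at hn
    have ha : 0 < c₀ * r / 2 * ε := by positivity
    have hl : 0 < lastCoord x := ha.trans_le hxT.1
    have hlε : lastCoord x ≤ ε := hxT.2.trans (by nlinarith)
    refine mul_le_mul (Real.rpow_le_rpow ha.le (hxT.1.trans (le_abs_self _)) hβ)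
      (Real.rpow_le_rpow_of_nonpos (by positivity) ?_ (by linarith)) (by positivity)
      (by positivity)
    have : primeNorm x ^ 2 ≤ 1 := by nlinarith
    nlinarith [mul_le_mul_of_nonneg_left this (sq_nonneg ε)]
  have hsub : T ⊆ {x | |lastCoord x| < c₀} := by
    intro x hx
    have ha : 0 < c₀ * r / 2 * ε := by positivity
    refine abs_lt.2 ⟨by linarith [hx.1], hx.2.trans_lt (by nlinarith)⟩
  have hband := sphereMeasure_band_ge hm hr hrm hc₀ hc₀' hε (by linarith)
  have hpow : ε ^ (-δ) = ε ^ β * (ε ^ 2) ^ (-p) * ε := by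
    rw [← Real.rpow_natCast, ← Real.rpow_mul hε.le, ← Real.rpow_add hε,
      ← Real.rpow_add_one hε.ne']
    congr 1
    push_cast
    rw [hp]
    ring
  calc _ = (c₀ * r / 2 * ε) ^ β * (2 * ε ^ 2) ^ (-p) * (r ^ m * (c₀ * r / 2 * ε)) := by
        rw [hpow, Real.mul_rpow (by positivity : 0 ≤ c₀ * r / 2) hε.le,
          Real.mul_rpow zero_le_two (by positivity)]
        ring
    _ ≤ (c₀ * r / 2 * ε) ^ β * (2 * ε ^ 2) ^ (-p) * (sphereMeasure (m + 1)).real T :=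
        mul_le_mul_of_nonneg_left hband (by positivity)
    _ = ∫ _ in T, (c₀ * r / 2 * ε) ^ β * (2 * ε ^ 2) ^ (-p) ∂(sphereMeasure (m + 1)) := by
        rw [setIntegral_const, smul_eq_mul, mul_comm]
    _ ≤ ∫ x in T, F x ∂(sphereMeasure (m + 1)) :=
        setIntegral_mono_on_ae (integrable_const _).integrableOn hFi.integrableOn hTm hlow
    _ ≤ _ := setIntegral_mono_set hFi.integrableOn (Filter.Eventually.of_forall hF0)
        hsub.eventuallyLE
end
end

section
/- Let n ≥ 2 and let s > −1 be a real number. There exists a constant C > 0 depending only on n and s such that for every ε ∈ (0, 1), ∫_{S^{n−1}} (ε²|x'|² + x_n²)^{s/2} dx ≤ C. -/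
open MeasureTheory Metric Real
open scoped ENNReal Topology

noncomputable section

/-- If `g` does not decrease when points are moved towards the origin, its integral over the unit
sphere is controlled by its integral over the unit ball. -/
lemma lintegral_toSphere_mul_le_setLIntegral_ball {E : Type*} [NormedAddCommGroup E]
    [NormedSpace ℝ E] [FiniteDimensional ℝ E] [MeasurableSpace E] [BorelSpace E]
    (μ : Measure E) [μ.IsAddHaarMeasure] {g : E → ℝ≥0∞} (hg : Measurable g)
    (hmono : ∀ (r : ℝ) (y : E), 0 < r → r < 1 → g y ≤ g (r • y)) :
    (∫⁻ y, g y ∂μ.toSphere) *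
        Measure.volumeIoiPow (Module.finrank ℝ E - 1) (Set.Iio ⟨1, Set.mem_Ioi.2 one_pos⟩) ≤
      ∫⁻ x in ball 0 1, g x ∂μ := by
  set a : Set.Ioi (0 : ℝ) := ⟨1, Set.mem_Ioi.2 one_pos⟩
  have hmp := μ.measurePreserving_homeomorphUnitSphereProd
  have hind : Measurable ((Set.Iio a).indicator (1 : Set.Ioi (0 : ℝ) → ℝ≥0∞)) :=
    measurable_one.indicator measurableSet_Iio
  calc
    _ = ∫⁻ z : sphere (0 : E) 1 × Set.Ioi (0 : ℝ), g z.1 * (Set.Iio a).indicator 1 z.2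
          ∂(μ.toSphere.prod (Measure.volumeIoiPow (Module.finrank ℝ E - 1))) := by
      rw [lintegral_prod_mul (f := fun y : sphere (0 : E) 1 => g y)
        (hg.comp measurable_subtype_coe).aemeasurable hind.aemeasurable,
        lintegral_indicator_one measurableSet_Iio]
    _ = ∫⁻ x : ({0}ᶜ : Set E), g (homeomorphUnitSphereProd E x).1 *
          (Set.Iio a).indicator 1 (homeomorphUnitSphereProd E x).2 ∂(μ.comap (↑)) :=
      (hmp.lintegral_comp (((hg.comp measurable_subtype_coe).comp measurable_fst).mul
        (hind.comp measurable_snd))).symm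
    _ ≤ ∫⁻ x : ({0}ᶜ : Set E), (ball 0 1).indicator g x ∂(μ.comap (↑)) := by
      refine lintegral_mono fun x => ?_
      by_cases hx : (homeomorphUnitSphereProd E x).2 ∈ Set.Iio a
      · have hx1 : ‖(x : E)‖ < 1 := by
          simpa [a, ← Subtype.coe_lt_coe] using hx
        have hx0 : 0 < ‖(x : E)‖ := norm_pos_iff.2 x.2
        rw [Set.indicator_of_mem hx, Set.indicator_of_mem (by simpa using hx1)]
        have h := hmono ‖(x : E)‖ (homeomorphUnitSphereProd E x).1 hx0 hx1
        simpa [smul_smul, hx0.ne'] using h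
      · simp [Set.indicator_of_notMem hx]
    _ = ∫⁻ x in ({0}ᶜ : Set E), (ball 0 1).indicator g x ∂μ :=
      lintegral_subtype_comap (measurableSet_singleton _).compl _
    _ ≤ ∫⁻ x, (ball 0 1).indicator g x ∂μ := setLIntegral_le_lintegral _ _
    _ = _ := lintegral_indicator measurableSet_ball _

lemma setLIntegral_enorm_rpow_Icc_lt_top {s : ℝ} (hs : -1 < s) :
    ∫⁻ t in Set.Icc (-1 : ℝ) 1, ‖t‖ₑ ^ s < ∞ := by
  have hint : IntervalIntegrable (fun t : ℝ => |t| ^ s) volume (-1) 1 := by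
    refine intervalIntegrable_of_even (by simp) fun x hx => ?_
    refine (intervalIntegral.intervalIntegrable_rpow' (a := 0) (b := x) hs).congr fun t ht => ?_
    rw [Set.uIoc_of_le hx.le] at ht
    simp [abs_of_pos ht.1]
  rw [intervalIntegrable_iff_integrableOn_Icc_of_le (by norm_num)] at hint
  have hfin := hint.2
  rw [hasFiniteIntegral_iff_enorm] at hfin
  refine lt_of_eq_of_lt (lintegral_congr_ae ?_) hfin
  refine ae_restrict_of_ae ?_
  filter_upwards [Measure.ae_ne volume (0 : ℝ)] with t ht
  rw [Real.enorm_of_nonneg (r := |t| ^ s) (by positivity),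
    ← ENNReal.ofReal_rpow_of_pos (abs_pos.2 ht), Real.enorm_eq_ofReal_abs]

lemma setLIntegral_ball_enorm_coord_rpow_lt_top {ι : Type*} [Fintype ι] (i : ι) {s : ℝ}
    (hs : -1 < s) :
    ∫⁻ x in ball (0 : EuclideanSpace ℝ ι) 1, ‖x i‖ₑ ^ s < ∞ := by
  classical
  have hmeas : Measurable fun t : ℝ => ‖t‖ₑ ^ s := by fun_prop
  set Q : Set (ι → ℝ) := Set.univ.pi fun _ => Set.Icc (-1 : ℝ) 1
  have hQ : MeasurableSet Q := MeasurableSet.univ_pi fun _ => measurableSet_Icc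
  calc
    _ ≤ ∫⁻ x in (WithLp.ofLp : EuclideanSpace ℝ ι → ι → ℝ) ⁻¹' Q, ‖x i‖ₑ ^ s := by
      refine lintegral_mono_set fun x hx j _ => ?_
      have h : ‖x j‖ ≤ ‖x‖ := PiLp.norm_apply_le x j
      exact abs_le.1 (h.trans (mem_ball_zero_iff.1 hx).le)
    _ = ∫⁻ x in Q, ‖x i‖ₑ ^ s :=
      (PiLp.volume_preserving_ofLp ι).setLIntegral_comp_preimage hQ
        (f := fun x : ι → ℝ => ‖x i‖ₑ ^ s) (hmeas.comp (measurable_pi_apply i))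
    _ = ∫⁻ t, ‖t‖ₑ ^ s ∂((Measure.pi fun _ : ι =>
          (volume : Measure ℝ).restrict (Set.Icc (-1) 1)).map (Function.eval i)) := by
      rw [lintegral_map hmeas (measurable_pi_apply i), volume_pi, Measure.restrict_pi_pi]
    _ < ∞ := by
      rw [Measure.pi_map_eval, lintegral_smul_measure, smul_eq_mul]
      refine ENNReal.mul_lt_top (ENNReal.prod_lt_top fun j _ => ?_)
        (setLIntegral_enorm_rpow_Icc_lt_top hs)
      simp

lemma lintegral_toSphere_enorm_coord_rpow_lt_top {ι : Type*} [Fintype ι] (i : ι) {s : ℝ}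
    (hs : -1 < s) (hs0 : s ≤ 0) :
    ∫⁻ y, ‖(y : EuclideanSpace ℝ ι) i‖ₑ ^ s
      ∂(volume : Measure (EuclideanSpace ℝ ι)).toSphere < ∞ := by
  have hmeas : Measurable fun x : EuclideanSpace ℝ ι => ‖x i‖ₑ ^ s := by fun_prop
  have hle := (lintegral_toSphere_mul_le_setLIntegral_ball volume hmeas
    fun r y hr0 hr1 => ?_).trans_lt (setLIntegral_ball_enorm_coord_rpow_lt_top i hs)
  · refine (ENNReal.mul_lt_top_iff.1 hle).elim (fun h => h.1) fun h => h.elim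
      (fun h => by simp [h]) fun h => absurd h ?_
    rw [Measure.volumeIoiPow_apply_Iio]
    simp only [ENNReal.ofReal_eq_zero, not_le]
    positivity
  · rw [← neg_neg s, ENNReal.rpow_neg _ (-s), ENNReal.rpow_neg _ (-s), ENNReal.inv_le_inv]
    refine ENNReal.rpow_le_rpow ?_ (by linarith)
    rw [PiLp.smul_apply, enorm_smul]
    refine mul_le_of_le_one_left' ?_
    rw [Real.enorm_of_nonneg hr0.le]
    exact ENNReal.ofReal_le_one.2 hr1.le

lemma measurableEmbedding_sphere_coe (n : ℕ) :
    MeasurableEmbedding (Subtype.val : sphere (0 : EuclideanSpace ℝ (Fin n)) 1 → _) :=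
  MeasurableEmbedding.subtype_coe isClosed_sphere.measurableSet

lemma exists_lastCoord_eq {n : ℕ} (hn : n ≠ 0) :
    ∃ i : Fin n, ∀ x : EuclideanSpace ℝ (Fin n), lastCoord x = x i :=
  ⟨⟨n - 1, Nat.sub_lt (Nat.pos_of_ne_zero hn) one_pos⟩, fun x => by simp [lastCoord, hn]⟩

lemma primeNorm_sq_le {n : ℕ} (x : EuclideanSpace ℝ (Fin n)) : primeNorm x ^ 2 ≤ ‖x‖ ^ 2 := by
  rw [primeNorm, Real.sq_sqrt (Finset.sum_nonneg fun i _ => by split_ifs <;> positivity),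
    EuclideanSpace.real_norm_sq_eq]
  refine Finset.sum_le_sum fun i _ => ?_
  split_ifs
  · exact le_rfl
  · positivity

lemma enorm_add_sq_rpow_le {a t s : ℝ} (ha : 0 ≤ a) (hs : s ≤ 0) :
    ‖(a + t ^ 2) ^ (s / 2)‖ₑ ≤ ‖t‖ₑ ^ s := by
  rcases hs.eq_or_lt with rfl | hs
  · simp
  rcases eq_or_ne t 0 with rfl | ht
  · simp [ENNReal.zero_rpow_of_neg hs]
  rw [Real.enorm_of_nonneg (by positivity), Real.enorm_eq_ofReal_abs,
    ENNReal.ofReal_rpow_of_pos (abs_pos.2 ht)]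
  refine ENNReal.ofReal_le_ofReal ?_
  calc
    (a + t ^ 2) ^ (s / 2) ≤ (t ^ 2) ^ (s / 2) :=
      Real.rpow_le_rpow_of_nonpos (by positivity) (by linarith) (by linarith)
    _ = |t| ^ s := by
      rw [← sq_abs, ← Real.rpow_natCast, ← Real.rpow_mul (abs_nonneg t)]
      congr 1
      push_cast
      ring

/-- used in the proof of Lemma 4.1.
For `s > -1` there is `C > 0` such that for every `ε ∈ (0, 1)`,
`∫_{S^{n-1}} (ε²|x'|² + x_n²)^{s/2} dx ≤ C`. -/
theorem sphere_integral_uniform_upper_bound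
    (n : ℕ) (hn : 2 ≤ n) (s : ℝ) (hs : -1 < s) :
    ∃ C : ℝ, 0 < C ∧ ∀ ε : ℝ, 0 < ε → ε < 1 →
      (∫ x, (ε ^ 2 * primeNorm x ^ 2 + lastCoord x ^ 2) ^ (s / 2) ∂(sphereMeasure n)) ≤ C := by
  obtain ⟨i, hi⟩ := exists_lastCoord_eq (n := n) (by omega)
  set σ := (volume : Measure (EuclideanSpace ℝ (Fin n))).toSphere
  suffices h : ∃ g : sphere (0 : EuclideanSpace ℝ (Fin n)) 1 → ℝ≥0∞, ∫⁻ y, g y ∂σ < ∞ ∧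
      ∀ ε : ℝ, 0 < ε → ε < 1 → ∀ y : sphere (0 : EuclideanSpace ℝ (Fin n)) 1,
        ‖(ε ^ 2 * primeNorm y.1 ^ 2 + lastCoord y.1 ^ 2) ^ (s / 2)‖ₑ ≤ g y by
    obtain ⟨g, hfin, hg⟩ := h
    refine ⟨(∫⁻ y, g y ∂σ).toReal + 1, by positivity, fun ε h0 h1 => ?_⟩
    rw [sphereMeasure, (measurableEmbedding_sphere_coe n).integral_map]
    have hle := (enorm_integral_le_lintegral_enorm _).trans (lintegral_mono (μ := σ) (hg ε h0 h1))
    have hnorm := ENNReal.toReal_mono hfin.ne hle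
    rw [toReal_enorm] at hnorm
    linarith [(Real.le_norm_self _).trans hnorm]
  rcases le_total s 0 with hs0 | hs0
  · refine ⟨fun y => ‖y.1 i‖ₑ ^ s, lintegral_toSphere_enorm_coord_rpow_lt_top i hs hs0,
      fun ε _ _ y => ?_⟩
    rw [hi]
    exact enorm_add_sq_rpow_le (by positivity) hs0
  · refine ⟨fun _ => ENNReal.ofReal (2 ^ (s / 2)), ?_, fun ε h0 h1 y => ?_⟩
    · rw [lintegral_const]
      exact ENNReal.mul_lt_top ENNReal.ofReal_lt_top (measure_lt_top σ _)
    have hy : ‖y.1‖ = 1 := norm_eq_of_mem_sphere y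
    have hprime := primeNorm_sq_le y.1
    have hlast : lastCoord y.1 ^ 2 ≤ 1 := by
      rw [hi, sq_le_one_iff_abs_le_one]
      exact (PiLp.norm_apply_le y.1 i).trans_eq hy
    rw [hy, one_pow] at hprime
    have hε : ε ^ 2 ≤ 1 := pow_le_one₀ h0.le h1.le
    rw [Real.enorm_of_nonneg (by positivity)]
    refine ENNReal.ofReal_le_ofReal (Real.rpow_le_rpow (by positivity) ?_ (by positivity))
    linarith [mul_le_one₀ hε (sq_nonneg (primeNorm y.1)) hprime]
end
end
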